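/- For every δ > 0, the quantity (1/n)·∫_{δ}^{a_n} ∫_{δ}^{a_n} Φ(min(x,y))·(1 − Φ(max(x,y))) / (φ(x)·φ(y)) dx dy tends to 0 as n → ∞. -/

import Mathlib

open Real MeasureTheory Filter

/-- The standard normal density. -/
noncomputable def stdNormalPDF (x : ℝ) : ℝ := (Real.sqrt (2 * Real.pi))⁻¹ * Real.exp (-x ^ 2 / 2)

/-- The standard normal distribution function. -/
noncomputable def stdNormalCDF (x : ℝ) : ℝ := ∫ t in Set.Iic x, stdNormalPDF t

theorem stdNormalPDF_eq_gaussianPDFReal :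
    stdNormalPDF = ProbabilityTheory.gaussianPDFReal 0 1 := by
  ext x
  simp [stdNormalPDF, ProbabilityTheory.gaussianPDFReal]

theorem stdNormalPDF_pos (x : ℝ) : 0 < stdNormalPDF x := by
  unfold stdNormalPDF
  positivity

theorem integrable_stdNormalPDF : Integrable stdNormalPDF := by
  rw [stdNormalPDF_eq_gaussianPDFReal]
  exact ProbabilityTheory.integrable_gaussianPDFReal 0 1

theorem one_sub_stdNormalCDF (x : ℝ) :
    1 - stdNormalCDF x = ∫ t in Set.Ioi x, stdNormalPDF t := by
  have h1 : ∫ t, stdNormalPDF t = 1 := by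
    rw [stdNormalPDF_eq_gaussianPDFReal]
    exact ProbabilityTheory.integral_gaussianPDFReal_eq_one 0 one_ne_zero
  rw [stdNormalCDF, ← h1, sub_eq_iff_eq_add', ← Set.compl_Iic,
    integral_add_compl measurableSet_Iic integrable_stdNormalPDF]

theorem stdNormalCDF_nonneg (x : ℝ) : 0 ≤ stdNormalCDF x :=
  setIntegral_nonneg measurableSet_Iic fun t _ => (stdNormalPDF_pos t).le

theorem stdNormalCDF_lt_one (x : ℝ) : stdNormalCDF x < 1 := by
  rw [← sub_pos, one_sub_stdNormalCDF,
    setIntegral_pos_iff_support_of_nonneg_ae (ae_of_all _ fun t => (stdNormalPDF_pos t).le)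
      integrable_stdNormalPDF.integrableOn]
  have : Function.support stdNormalPDF = Set.univ :=
    Set.eq_univ_of_forall fun t => (stdNormalPDF_pos t).ne'
  simp [this]

theorem stdNormalCDF_mono : Monotone stdNormalCDF := fun _ _ h =>
  setIntegral_mono_set integrable_stdNormalPDF.integrableOn
    (ae_of_all _ fun t => (stdNormalPDF_pos t).le) (Set.Iic_subset_Iic.2 h).eventuallyLE

theorem hasDerivAt_neg_stdNormalPDF (x : ℝ) :
    HasDerivAt (fun t => -stdNormalPDF t) (x * stdNormalPDF x) x := by
  have h := ((((hasDerivAt_id x).pow 2).neg.div_const 2).exp.const_mul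
    ((Real.sqrt (2 * Real.pi))⁻¹)).neg
  refine h.congr_deriv ?_
  simp [stdNormalPDF]
  ring

/-- The Mills ratio bound for the Gaussian tail. -/
theorem one_sub_stdNormalCDF_le {x : ℝ} (hx : 0 < x) :
    1 - stdNormalCDF x ≤ stdNormalPDF x / x := by
  have hlim : Tendsto (fun t => -stdNormalPDF t) atTop (nhds 0) := by
    have h : Tendsto (fun t : ℝ => -t ^ 2 / 2) atTop atBot := by
      have := (tendsto_pow_atTop (α := ℝ) two_ne_zero).atTop_div_const (two_pos (α := ℝ))
      simpa [neg_div] using this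
    simpa [stdNormalPDF] using
      ((Real.tendsto_exp_atBot.comp h).const_mul ((Real.sqrt (2 * Real.pi))⁻¹)).neg
  have hpos : ∀ t ∈ Set.Ioi x, 0 ≤ t * stdNormalPDF t := fun t ht =>
    mul_nonneg (hx.trans ht).le (stdNormalPDF_pos t).le
  have hint := integrableOn_Ioi_deriv_of_nonneg'
    (fun t (_ : t ∈ Set.Ici x) => hasDerivAt_neg_stdNormalPDF t) hpos hlim
  have hval := integral_Ioi_of_hasDerivAt_of_nonneg'
    (fun t (_ : t ∈ Set.Ici x) => hasDerivAt_neg_stdNormalPDF t) hpos hlim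
  rw [one_sub_stdNormalCDF, le_div_iff₀ hx, mul_comm, ← integral_const_mul]
  calc _ ≤ ∫ t in Set.Ioi x, t * stdNormalPDF t :=
        setIntegral_mono_on (integrable_stdNormalPDF.integrableOn.const_mul x) hint
          measurableSet_Ioi fun t ht =>
            mul_le_mul_of_nonneg_right (le_of_lt ht) (stdNormalPDF_pos t).le
    _ = stdNormalPDF x := by simpa using hval

theorem inv_stdNormalPDF (x : ℝ) :
    (stdNormalPDF x)⁻¹ = √(2 * π) * exp (x ^ 2 / 2) := by
  rw [stdNormalPDF, mul_inv, inv_inv, ← exp_neg]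
  ring_nf

theorem gaussian_kernel_nonneg (x y : ℝ) :
    0 ≤ stdNormalCDF (min x y) * (1 - stdNormalCDF (max x y))
      / (stdNormalPDF x * stdNormalPDF y) :=
  div_nonneg (mul_nonneg (stdNormalCDF_nonneg _) (sub_nonneg.2 (stdNormalCDF_lt_one _).le))
    (mul_pos (stdNormalPDF_pos x) (stdNormalPDF_pos y)).le

/-- A separable bound for the kernel, from `min x y ^ 2 ≤ (x ^ 2 + y ^ 2) / 2`. -/
theorem gaussian_kernel_le {δ x y : ℝ} (hδ : 0 < δ) (hx : δ ≤ x) (hy : δ ≤ y) :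
    stdNormalCDF (min x y) * (1 - stdNormalCDF (max x y)) / (stdNormalPDF x * stdNormalPDF y)
      ≤ √(2 * π) / δ * exp (x ^ 2 / 4) * exp (y ^ 2 / 4) := by
  wlog hxy : x ≤ y generalizing x y
  · have h := this hy hx (le_of_not_ge hxy)
    rw [min_comm, max_comm, mul_comm (stdNormalPDF x)]
    linarith
  have hy0 : 0 < y := hδ.trans_le hy
  have hφy := stdNormalPDF_pos y
  have hφx := stdNormalPDF_pos x
  rw [min_eq_left hxy, max_eq_right hxy]
  calc _ ≤ 1 * (stdNormalPDF y / δ) / (stdNormalPDF x * stdNormalPDF y) := by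
        gcongr
        · exact sub_nonneg.2 (stdNormalCDF_lt_one _).le
        · exact (stdNormalCDF_lt_one _).le
        · exact (one_sub_stdNormalCDF_le hy0).trans (by gcongr)
    _ = (stdNormalPDF x)⁻¹ / δ := by field_simp
    _ = √(2 * π) / δ * exp (x ^ 2 / 2) := by rw [inv_stdNormalPDF]; ring
    _ ≤ √(2 * π) / δ * exp (x ^ 2 / 4 + y ^ 2 / 4) := by
        gcongr
        nlinarith
    _ = _ := by rw [exp_add, mul_assoc]

theorem integral_exp_sq_div_four_le {δ a : ℝ} (hδ : 0 < δ) (ha : δ ≤ a) :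
    ∫ x in δ..a, exp (x ^ 2 / 4) ≤ 2 / δ * exp (a ^ 2 / 4) := by
  have hderiv : ∀ x : ℝ, HasDerivAt (fun t => 2 / δ * exp (t ^ 2 / 4))
      (x / δ * exp (x ^ 2 / 4)) x := fun x => by
    refine ((((hasDerivAt_id x).pow 2).div_const 4).exp.const_mul (2 / δ)).congr_deriv ?_
    simp
    ring
  have hcont : Continuous fun x : ℝ => x / δ * exp (x ^ 2 / 4) := by fun_prop
  calc _ ≤ ∫ x in δ..a, x / δ * exp (x ^ 2 / 4) := by
        refine intervalIntegral.integral_mono_on ha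
          (Continuous.intervalIntegrable (by fun_prop) _ _) (hcont.intervalIntegrable _ _) ?_
        intro x hx
        exact le_mul_of_one_le_left (exp_pos _).le ((one_le_div hδ).2 hx.1)
    _ = 2 / δ * exp (a ^ 2 / 4) - 2 / δ * exp (δ ^ 2 / 4) :=
        intervalIntegral.integral_eq_sub_of_hasDerivAt (fun x _ => hderiv x)
          (hcont.intervalIntegrable _ _)
    _ ≤ _ := sub_le_self _ (by positivity)

theorem integral_gaussian_kernel_nonneg {δ a : ℝ} (ha : δ ≤ a) :
    0 ≤ ∫ x in δ..a, ∫ y in δ..a,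
      stdNormalCDF (min x y) * (1 - stdNormalCDF (max x y))
        / (stdNormalPDF x * stdNormalPDF y) :=
  intervalIntegral.integral_nonneg ha fun x _ =>
    intervalIntegral.integral_nonneg ha fun y _ => gaussian_kernel_nonneg x y

theorem integral_gaussian_kernel_le {δ a : ℝ} (hδ : 0 < δ) (ha : δ ≤ a) :
    ∫ x in δ..a, ∫ y in δ..a,
      stdNormalCDF (min x y) * (1 - stdNormalCDF (max x y))
        / (stdNormalPDF x * stdNormalPDF y)
      ≤ √(2 * π) / δ * (2 / δ) ^ 2 * exp (a ^ 2 / 2) := by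
  have hinner : ∀ x ∈ Set.Ioc δ a, ‖∫ y in δ..a,
      stdNormalCDF (min x y) * (1 - stdNormalCDF (max x y))
        / (stdNormalPDF x * stdNormalPDF y)‖
      ≤ √(2 * π) / δ * (∫ y in δ..a, exp (y ^ 2 / 4)) * exp (x ^ 2 / 4) := fun x hx => by
    refine (intervalIntegral.norm_integral_le_of_norm_le ha
      (g := fun y => √(2 * π) / δ * exp (x ^ 2 / 4) * exp (y ^ 2 / 4))
      (ae_of_all _ fun y hy => ?_) (Continuous.intervalIntegrable (by fun_prop) _ _)).trans_eq ?_
    · rw [norm_of_nonneg (gaussian_kernel_nonneg x y)]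
      exact gaussian_kernel_le hδ hx.1.le hy.1.le
    · rw [intervalIntegral.integral_const_mul]
      ring
  have hI : 0 ≤ ∫ y in δ..a, exp (y ^ 2 / 4) :=
    intervalIntegral.integral_nonneg ha fun y _ => (exp_pos _).le
  calc _ ≤ ∫ x in δ..a, √(2 * π) / δ * (∫ y in δ..a, exp (y ^ 2 / 4)) * exp (x ^ 2 / 4) :=
        (le_norm_self _).trans (intervalIntegral.norm_integral_le_of_norm_le ha
          (ae_of_all _ hinner) (Continuous.intervalIntegrable (by fun_prop) _ _))
    _ = √(2 * π) / δ * (∫ y in δ..a, exp (y ^ 2 / 4)) ^ 2 := by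
        rw [intervalIntegral.integral_const_mul]
        ring
    _ ≤ √(2 * π) / δ * (2 / δ * exp (a ^ 2 / 4)) ^ 2 := by
        gcongr
        exact integral_exp_sq_div_four_le hδ ha
    _ = _ := by
        rw [mul_pow, ← exp_nat_mul, ← mul_assoc]
        congr 2
        push_cast
        ring

theorem tendsto_atTop_of_stdNormalCDF_eq {a : ℕ → ℝ}
    (ha : ∀ n : ℕ, 2 ≤ n → stdNormalCDF (a n) = 1 - 1 / n) : Tendsto a atTop atTop := by
  refine tendsto_atTop.2 fun M => ?_
  have hlim := tendsto_one_div_atTop_nhds_zero_nat (𝕜 := ℝ)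
  filter_upwards [hlim.eventually_lt_const (sub_pos.2 (stdNormalCDF_lt_one M)),
    eventually_ge_atTop 2] with n hn hn2
  by_contra! h
  have := stdNormalCDF_mono h.le
  rw [ha n hn2] at this
  linarith

theorem stmt_12 (a : ℕ → ℝ) (ha : ∀ n : ℕ, 2 ≤ n → stdNormalCDF (a n) = 1 - 1 / n)
    (δ : ℝ) (hδ : 0 < δ) :
    Tendsto (fun n : ℕ => (1 / n : ℝ) *
        ∫ x in δ..(a n), ∫ y in δ..(a n),
          stdNormalCDF (min x y) * (1 - stdNormalCDF (max x y))
            / (stdNormalPDF x * stdNormalPDF y))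
      atTop (nhds 0) := by
  have hlim := tendsto_atTop_of_stdNormalCDF_eq ha
  have hbound : Tendsto (fun n => 1 / δ * (2 / δ) ^ 2 / a n) atTop (nhds 0) :=
    tendsto_const_nhds.div_atTop hlim
  refine tendsto_of_tendsto_of_tendsto_of_le_of_le' tendsto_const_nhds hbound ?_ ?_
  · filter_upwards [hlim.eventually_ge_atTop δ] with n hn
    exact mul_nonneg (by positivity) (integral_gaussian_kernel_nonneg hn)
  · filter_upwards [hlim.eventually_ge_atTop δ, eventually_ge_atTop 2] with n hn hn2
    have han : 0 < a n := hδ.trans_le hn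
    have hφ := stdNormalPDF_pos (a n)
    have hQ : (1 / n : ℝ) ≤ stdNormalPDF (a n) / a n := by
      have := one_sub_stdNormalCDF_le han
      rw [ha n hn2] at this
      linarith
    calc _ ≤ stdNormalPDF (a n) / a n * (√(2 * π) / δ * (2 / δ) ^ 2 * exp (a n ^ 2 / 2)) :=
          mul_le_mul hQ (integral_gaussian_kernel_le hδ hn) (integral_gaussian_kernel_nonneg hn)
            (by positivity)
      _ = stdNormalPDF (a n) * (√(2 * π) * exp (a n ^ 2 / 2)) * (1 / δ * (2 / δ) ^ 2 / a n) := by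
          ring
      _ = _ := by rw [← inv_stdNormalPDF, mul_inv_cancel₀ hφ.ne', one_mul]
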